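/- arXiv:1910.09843 — 4 statements merged into one kernel-verified Lean document; each statement's English description precedes it below -/
import Mathlib

section
/- Let d ≥ 1, m > 1, τ > 0, ε_k ≥ 0 with ε_k → 0, δ_k ≥ 0 with δ_k → 0, tesselations 𝒯_{δ_k} and costs c_k := c_{τ,δ_k} satisfying the standing hypotheses with constants α_k → 0, and let (ρ_k) be probability densities in P₂(ℝ^d) converging in W₂ to ρ_* with sup_k E(ρ_k) < ∞. If γ_k ∈ Γ(ρ_k) converge narrowly to γ_* ∈ Γ(ρ_*), then E^τ_*(γ_*) ≤ liminf_{k→∞} E^τ_k(γ_k), where E^τ_k := E^τ_{ε_k,δ_k}(·|ρ_k) and E^τ_*(γ) = ∬ c_τ dγ + (1/τ)E(Y#γ) for X#γ = ρ_*ℒ^d (and +∞ otherwise). -/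
open MeasureTheory Filter Topology BoundedContinuousFunction
open scoped ENNReal NNReal

noncomputable section
open scoped Classical

/-- Euclidean space `ℝ^d`. -/
abbrev Rd (d : ℕ) : Type := EuclideanSpace ℝ (Fin d)

/-- The product space `ℝ^d × ℝ^d`. -/
abbrev Rd2 (d : ℕ) : Type := Rd d × Rd d

/-- Second moment of a measure on `ℝ^d`. -/
def secondMoment {d : ℕ} (μ : Measure (Rd d)) : ℝ≥0∞ :=
  ∫⁻ x, (‖x‖₊ : ℝ≥0∞) ^ 2 ∂μ

/-- Second moment `∬ (|x|² + |y|²) dγ` of a measure on `ℝ^d × ℝ^d`. -/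
def pairSecondMoment {d : ℕ} (γ : Measure (Rd2 d)) : ℝ≥0∞ :=
  ∫⁻ p, ((‖p.1‖₊ : ℝ≥0∞) ^ 2 + (‖p.2‖₊ : ℝ≥0∞) ^ 2) ∂γ

/-- Narrow convergence of a sequence of measures: convergence of the integrals of all
bounded continuous functions. -/
def NarrowTendsto {X : Type*} [TopologicalSpace X] [MeasurableSpace X]
    (μ : ℕ → Measure X) (μlim : Measure X) : Prop :=
  ∀ f : X →ᵇ ℝ, Tendsto (fun k => ∫ x, f x ∂(μ k)) atTop (𝓝 (∫ x, f x ∂μlim))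

/-- Convergence in the `L²`-Wasserstein sense: narrow convergence together with
convergence of second moments. -/
def W2Tendsto {d : ℕ} (μ : ℕ → Measure (Rd d)) (μlim : Measure (Rd d)) : Prop :=
  NarrowTendsto μ μlim ∧
    Tendsto (fun k => secondMoment (μ k)) atTop (𝓝 (secondMoment μlim))

/-- Convergence in the `L²`-Wasserstein sense for measures on `ℝ^d × ℝ^d`. -/
def W2TendstoPair {d : ℕ} (γ : ℕ → Measure (Rd2 d)) (γlim : Measure (Rd2 d)) : Prop :=
  NarrowTendsto γ γlim ∧
    Tendsto (fun k => pairSecondMoment (γ k)) atTop (𝓝 (pairSecondMoment γlim))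

/-- Negative entropy `H(γ) = ∬ G log G` if `γ = G·vol` is absolutely continuous
(computed as difference of the positive and negative parts in `EReal`), and `+∞` otherwise. -/
def entropy {X : Type*} [MeasurableSpace X] (vol γ : Measure X) : EReal :=
  if γ ≪ vol then
    ((∫⁻ x, ENNReal.ofReal ((γ.rnDeriv vol x).toReal * Real.log (γ.rnDeriv vol x).toReal) ∂vol :
        ℝ≥0∞) : EReal)
      - ((∫⁻ x, ENNReal.ofReal (-((γ.rnDeriv vol x).toReal * Real.log (γ.rnDeriv vol x).toReal)) ∂vol :
        ℝ≥0∞) : EReal)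
  else ⊤

/-- Energy `E(ρ) = ∫ ρ^m dx` for `μ = ρ·ℒ^d` absolutely continuous, `+∞` otherwise. -/
def energy {d : ℕ} (m : ℝ) (μ : Measure (Rd d)) : ℝ≥0∞ :=
  if μ ≪ (volume : Measure (Rd d)) then
    ∫⁻ x, (μ.rnDeriv volume x) ^ m ∂(volume : Measure (Rd d))
  else ⊤

/-- A tesselation of `ℝ^d` with mesh size `δ`: countably many open, pairwise disjoint
cells whose closures cover `ℝ^d`, with `diam Q ≤ √d·δ` and `ℒ^d(Q) ≥ (r̲δ)^d`. -/
structure Tesselation (d : ℕ) (δ rlow : ℝ) where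
  cells : Set (Set (Rd d))
  countable : cells.Countable
  isOpen : ∀ Q ∈ cells, IsOpen Q
  pairwiseDisjoint : cells.PairwiseDisjoint id
  covers : (⋃ Q ∈ cells, closure Q) = Set.univ
  diam_le : ∀ Q ∈ cells, Metric.diam Q ≤ Real.sqrt d * δ
  volume_ge : ∀ Q ∈ cells, ENNReal.ofReal ((rlow * δ) ^ d) ≤ volume Q

/-- `μ` is given by a density which is constant on each cell of the tesselation. -/
def IsPiecewiseConstProb {d : ℕ} (cells : Set (Set (Rd d))) (μ : Measure (Rd d)) : Prop :=
  ∃ ρ : Rd d → ℝ≥0∞, Measurable ρ ∧ μ = (volume : Measure (Rd d)).withDensity ρ ∧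
    ∀ Q ∈ cells, ∀ x ∈ Q, ∀ y ∈ Q, ρ x = ρ y

/-- The cost function `Cf`: strictly convex, continuous, nonnegative and bounded on the closed
unit ball (there given by the real-valued `C0`), with `Cf(0) = 0`, `Cf ≡ 1` on the unit sphere
and `Cf = +∞` outside the closed unit ball. -/
structure CostFn (d : ℕ) where
  C : Rd d → ℝ≥0∞
  C0 : Rd d → ℝ
  measurable : Measurable C
  nonneg : ∀ v, 0 ≤ C0 v
  continuousOn : ContinuousOn C0 (Metric.closedBall (0 : Rd d) 1)
  strictConvexOn : StrictConvexOn ℝ (Metric.closedBall (0 : Rd d) 1) C0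
  zero : C0 0 = 0
  boundary : ∀ v : Rd d, ‖v‖ = 1 → C0 v = 1
  eq_inside : ∀ v : Rd d, ‖v‖ ≤ 1 → C v = ENNReal.ofReal (C0 v)
  eq_outside : ∀ v : Rd d, 1 < ‖v‖ → C v = ⊤

/-- The induced transport cost `c_τ(x,y) = Cf((y−x)/τ)` (convex domain `Ω = ℝ^d`). -/
def cCost {d : ℕ} (Cf : CostFn d) (τ : ℝ) (p : Rd2 d) : ℝ≥0∞ :=
  Cf.C (τ⁻¹ • (p.2 - p.1))

/-- `∬ c dγ`. -/
def costIntegral {d : ℕ} (c : Rd2 d → ℝ≥0∞) (γ : Measure (Rd2 d)) : ℝ≥0∞ :=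
  ∫⁻ p, c p ∂γ

/-- The standing hypotheses on the approximate cost `c_{τ,δ}` with constant `α = α_{τ,δ}`:
`|c_{τ,δ} − c_τ| ≤ α` on `{|x−y| ≤ τ}` and
`c_{τ,δ}(x,y) ≥ 1 − α + (|y−x|−τ)²/α` on `{|x−y| > τ}`. -/
def ApproxCost {d : ℕ} (Cf : CostFn d) (τ α : ℝ) (c : Rd2 d → ℝ≥0∞) : Prop :=
  Measurable c ∧
    (∀ p : Rd2 d, dist p.1 p.2 ≤ τ →
      c p ≤ cCost Cf τ p + ENNReal.ofReal α ∧ cCost Cf τ p ≤ c p + ENNReal.ofReal α) ∧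
    (∀ p : Rd2 d, τ < dist p.1 p.2 →
      ENNReal.ofReal (1 - α + (dist p.1 p.2 - τ) ^ 2 / α) ≤ c p)

/-- The regularized, spatially discretized JKO functional
`E^τ_{ε,δ}(γ|ρ̄) = ∬ c dγ + ε·H(γ) + (1/τ)·E(Y#γ)` subject to `X#γ = ρ̄` and `Y#γ ∈ P_δ`. -/
def JKOfun {d : ℕ} (τ ε m : ℝ) (Pδ : Measure (Rd d) → Prop) (c : Rd2 d → ℝ≥0∞)
    (ρbar : Measure (Rd d)) (γ : Measure (Rd2 d)) : EReal :=
  if γ.map Prod.fst = ρbar ∧ Pδ (γ.map Prod.snd) then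
    ((costIntegral c γ : ℝ≥0∞) : EReal) + (ε : EReal) * entropy (volume : Measure (Rd2 d)) γ
      + ((1 / τ : ℝ) : EReal) * ((energy m (γ.map Prod.snd) : ℝ≥0∞) : EReal)
  else ⊤

/-- The limiting functional `E^τ_*(γ) = ∬ c_τ dγ + (1/τ)·E(Y#γ)` subject to `X#γ = ρ_*`. -/
def JKOlimitPlanFun {d : ℕ} (Cf : CostFn d) (τ m : ℝ) (ρstar : Measure (Rd d))
    (γ : Measure (Rd2 d)) : EReal :=
  if γ.map Prod.fst = ρstar then
    ((costIntegral (cCost Cf τ) γ : ℝ≥0∞) : EReal)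
      + ((1 / τ : ℝ) : EReal) * ((energy m (γ.map Prod.snd) : ℝ≥0∞) : EReal)
  else ⊤

/-- One step of the unregularized JKO scheme:
`ρ ↦ inf{∬ c_τ dγ : X#γ = ρprev, Y#γ = ρ} + (1/τ)[E(ρ) − E(ρprev)]`. -/
def JKOlimitFun {d : ℕ} (Cf : CostFn d) (τ m : ℝ) (ρprev ρ : Measure (Rd d)) : EReal :=
  ((⨅ γ ∈ {γ : Measure (Rd2 d) | IsProbabilityMeasure γ ∧
      γ.map Prod.fst = ρprev ∧ γ.map Prod.snd = ρ}, costIntegral (cCost Cf τ) γ : ℝ≥0∞) : EReal)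
    + ((1 / τ : ℝ) : EReal) *
        (((energy m ρ : ℝ≥0∞) : EReal) - ((energy m ρprev : ℝ≥0∞) : EReal))

/-- Weak convergence in `L^m(ℝ^d)` of the densities of a sequence of (absolutely continuous)
measures, tested against all `g ∈ L^{m'}` with `m' = m/(m−1)`. -/
def WeakLmTendsto {d : ℕ} (m : ℝ) (μ : ℕ → Measure (Rd d)) (μlim : Measure (Rd d)) : Prop :=
  ∀ g : Rd d → ℝ, MemLp g (ENNReal.ofReal (m / (m - 1))) (volume : Measure (Rd d)) →
    Tendsto (fun k => ∫ x, ((μ k).rnDeriv volume x).toReal * g x) atTop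
      (𝓝 (∫ x, (μlim.rnDeriv volume x).toReal * g x))

/-- Superadditivity of the lower limit of extended nonnegative sequences. -/
lemma ENNReal.liminf_add_liminf_le (u v : ℕ → ℝ≥0∞) :
    liminf u atTop + liminf v atTop ≤ liminf (fun k => u k + v k) atTop := by
  simp only [liminf_eq_iSup_iInf_of_nat]
  rw [ENNReal.iSup_add_iSup_of_monotone]
  · refine iSup_mono fun n => le_iInf₂ fun i hi => add_le_add ?_ ?_
    · exact iInf₂_le i hi
    · exact iInf₂_le i hi
  · exact fun a b hab => le_iInf₂ fun i hi => iInf₂_le i (hab.trans hi)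
  · exact fun a b hab => le_iInf₂ fun i hi => iInf₂_le i (hab.trans hi)

/-- Narrow convergence, tested in `ℝ≥0∞` against a nonnegative bounded continuous function. -/
lemma NarrowTendsto.tendsto_lintegral {X : Type*} [TopologicalSpace X] [MeasurableSpace X]
    [OpensMeasurableSpace X] {μ : ℕ → Measure X} {μlim : Measure X}
    [∀ k, IsFiniteMeasure (μ k)] [IsFiniteMeasure μlim] (h : NarrowTendsto μ μlim)
    (f : X →ᵇ ℝ) (hf : ∀ x, 0 ≤ f x) :
    Tendsto (fun k => ∫⁻ x, ENNReal.ofReal (f x) ∂(μ k)) atTop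
      (𝓝 (∫⁻ x, ENNReal.ofReal (f x) ∂μlim)) := by
  have key : ∀ ν : Measure X, IsFiniteMeasure ν →
      ∫⁻ x, ENNReal.ofReal (f x) ∂ν = ENNReal.ofReal (∫ x, f x ∂ν) := fun ν _ =>
    (ofReal_integral_eq_lintegral_ofReal (f.integrable ν) (ae_of_all _ hf)).symm
  simp only [key _ inferInstance]
  exact ENNReal.tendsto_ofReal (h f)

/-- Narrow convergence is preserved by continuous push-forward. -/
lemma NarrowTendsto.map {X Y : Type*} [TopologicalSpace X] [MeasurableSpace X]
    [OpensMeasurableSpace X] [TopologicalSpace Y] [MeasurableSpace Y] [BorelSpace Y]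
    [TopologicalSpace.PseudoMetrizableSpace Y] [SecondCountableTopology Y]
    {μ : ℕ → Measure X} {μlim : Measure X} (h : NarrowTendsto μ μlim) {g : X → Y}
    (hg : Continuous g) : NarrowTendsto (fun k => (μ k).map g) (μlim.map g) := by
  intro f
  have key : ∀ ν : Measure X, ∫ y, f y ∂(ν.map g) = ∫ x, f (g x) ∂ν := fun ν =>
    integral_map hg.measurable.aemeasurable f.continuous.aestronglyMeasurable
  simp only [key]
  exact h (f.compContinuous ⟨g, hg⟩)

/-- The dual (Young) lower bound for the energy `∫ ρ^m`. -/
lemma mul_lintegral_le_energy_add {d : ℕ} {m p : ℝ} (hp : m.HolderConjugate p)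
    (μ : Measure (Rd d)) [IsFiniteMeasure μ] {φ : Rd d → ℝ≥0∞} (hφ : Measurable φ) :
    ENNReal.ofReal m * ∫⁻ x, φ x ∂μ ≤
      energy m μ + ENNReal.ofReal (m - 1) * ∫⁻ x, φ x ^ p := by
  unfold energy
  split_ifs with hac
  swap
  · simp
  rw [← lintegral_rnDeriv_mul hac hφ.aemeasurable, ← lintegral_const_mul _ (by fun_prop),
    ← lintegral_const_mul _ (by fun_prop), ← lintegral_add_left (by fun_prop)]
  refine lintegral_mono fun x => ?_
  have hm0 : ENNReal.ofReal m ≠ 0 := by simpa using hp.pos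
  have hmp : m / p = m - 1 := by
    rw [div_eq_iff hp.symm.pos.ne', hp.sub_one_mul_conj]
  calc ENNReal.ofReal m * (μ.rnDeriv volume x * φ x)
      ≤ ENNReal.ofReal m * ((μ.rnDeriv volume x) ^ m / ENNReal.ofReal m
          + φ x ^ p / ENNReal.ofReal p) := by
        gcongr
        exact ENNReal.young_inequality _ _ hp
    _ = (μ.rnDeriv volume x) ^ m + ENNReal.ofReal (m - 1) * φ x ^ p := by
        rw [mul_add, ENNReal.mul_div_cancel hm0 ENNReal.ofReal_ne_top, ← hmp,
          ENNReal.ofReal_div_of_pos hp.symm.pos]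
        simp only [div_eq_mul_inv]
        ring

/-- An inequality dual to a bound on the energy extends from `C_c` to `L^p` test functions. -/
lemma mul_eLpNorm_one_le_of_forall_continuous {d : ℕ} {m p : ℝ} (hp : 1 ≤ p)
    (μ : Measure (Rd d)) [IsProbabilityMeasure μ] {B : ℝ≥0∞}
    (h : ∀ φ : Rd d → ℝ, Continuous φ → HasCompactSupport φ →
      ENNReal.ofReal m * eLpNorm φ 1 μ ≤
        B + ENNReal.ofReal (m - 1) * eLpNorm φ (ENNReal.ofReal p) volume ^ p)
    {ψ : Rd d → ℝ} (hψ : MemLp ψ (ENNReal.ofReal p) (μ + volume)) :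
    ENNReal.ofReal m * eLpNorm ψ 1 μ ≤
      B + ENNReal.ofReal (m - 1) * eLpNorm ψ (ENNReal.ofReal p) volume ^ p := by
  set P := ENNReal.ofReal p
  have hP1 : 1 ≤ P := by simpa [P] using hp
  have : IsFiniteMeasureOnCompacts (μ + (volume : Measure (Rd d))) :=
    ⟨fun K hK => by simpa using hK.measure_lt_top⟩
  have hle : ∀ η : ℝ≥0∞, η ≠ 0 → ENNReal.ofReal m * eLpNorm ψ 1 μ ≤
      B + ENNReal.ofReal (m - 1) * (eLpNorm ψ P volume + η) ^ p + ENNReal.ofReal m * η := by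
    intro η hη
    obtain ⟨φ, hφs, hφη, hφc, -⟩ :=
      hψ.exists_hasCompactSupport_eLpNorm_sub_le ENNReal.ofReal_ne_top hη
    have hψμ : AEStronglyMeasurable ψ μ :=
      hψ.1.mono_measure (Measure.le_add_right le_rfl)
    have hψv : AEStronglyMeasurable ψ volume :=
      hψ.1.mono_measure (Measure.le_add_left le_rfl)
    have h1 : eLpNorm (ψ - φ) 1 μ ≤ η := by
      refine (eLpNorm_le_eLpNorm_of_exponent_le hP1
        (hψμ.sub hφc.aestronglyMeasurable)).trans (le_trans ?_ hφη)
      exact eLpNorm_mono_measure _ (Measure.le_add_right le_rfl)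
    have h2 : eLpNorm (ψ - φ) P volume ≤ η :=
      (eLpNorm_mono_measure _ (Measure.le_add_left le_rfl)).trans hφη
    have h3 : eLpNorm ψ 1 μ ≤ eLpNorm φ 1 μ + η := by
      calc eLpNorm ψ 1 μ = eLpNorm (φ + (ψ - φ)) 1 μ := by simp
        _ ≤ eLpNorm φ 1 μ + eLpNorm (ψ - φ) 1 μ :=
          eLpNorm_add_le hφc.aestronglyMeasurable (hψμ.sub hφc.aestronglyMeasurable) le_rfl
        _ ≤ _ := by gcongr
    have h4 : eLpNorm φ P volume ≤ eLpNorm ψ P volume + η := by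
      calc eLpNorm φ P volume = eLpNorm (ψ - (ψ - φ)) P volume := by simp
        _ ≤ eLpNorm ψ P volume + eLpNorm (ψ - φ) P volume :=
          eLpNorm_sub_le hψv (hψv.sub hφc.aestronglyMeasurable) hP1
        _ ≤ _ := by gcongr
    calc ENNReal.ofReal m * eLpNorm ψ 1 μ
        ≤ ENNReal.ofReal m * eLpNorm φ 1 μ + ENNReal.ofReal m * η := by
          rw [← mul_add]; gcongr
      _ ≤ _ := by
          gcongr
          refine (h φ hφc hφs).trans ?_
          gcongr
  have hlim : Tendsto (fun η : ℝ≥0∞ =>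
      B + ENNReal.ofReal (m - 1) * (eLpNorm ψ P volume + η) ^ p + ENNReal.ofReal m * η) (𝓝 0)
      (𝓝 (B + ENNReal.ofReal (m - 1) * (eLpNorm ψ P volume + 0) ^ p
        + ENNReal.ofReal m * 0)) := by
    refine Continuous.tendsto ?_ 0
    refine (continuous_const.add ?_).add (ENNReal.continuous_const_mul ENNReal.ofReal_ne_top)
    exact (ENNReal.continuous_const_mul ENNReal.ofReal_ne_top).comp
      (ENNReal.continuous_rpow_const.comp (continuous_const.add continuous_id))
  rw [mul_zero, add_zero, add_zero] at hlim
  exact ge_of_tendsto' (hlim.comp ENNReal.tendsto_inv_nat_nhds_zero)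
    fun n => hle _ (by simp)

/-- A measure satisfying the dual inequality for all `C_c` test functions has bounded energy. -/
lemma energy_le_of_forall_continuous {d : ℕ} {m p : ℝ} (hp : m.HolderConjugate p)
    (μ : Measure (Rd d)) [IsProbabilityMeasure μ] {B : ℝ≥0∞}
    (h : ∀ φ : Rd d → ℝ, Continuous φ → HasCompactSupport φ →
      ENNReal.ofReal m * eLpNorm φ 1 μ ≤
        B + ENNReal.ofReal (m - 1) * eLpNorm φ (ENNReal.ofReal p) volume ^ p) :
    energy m μ ≤ B := by
  rcases eq_or_ne B ⊤ with rfl | hB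
  · exact le_top
  have hp0 : 0 < p := hp.symm.pos
  have hext := fun ψ hψ =>
    mul_eLpNorm_one_le_of_forall_continuous hp.symm.lt.le μ h (ψ := ψ) hψ
  have hm0 : ENNReal.ofReal m ≠ 0 := by simpa using hp.pos
  have hac : μ ≪ (volume : Measure (Rd d)) := by
    refine Measure.AbsolutelyContinuous.mk fun A hA hA0 => ?_
    have ht : ∀ t : ℝ≥0, t * (ENNReal.ofReal m * μ A) ≤ B := by
      intro t
      have hmem : MemLp (A.indicator fun _ => (t : ℝ)) (ENNReal.ofReal p) (μ + volume) :=
        memLp_indicator_const _ hA _ (Or.inr (by simp [hA0]))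
      have := hext _ hmem
      rw [eLpNorm_one_eq_lintegral_enorm,
        eLpNorm_indicator_const₀ hA.nullMeasurableSet (by simpa using hp0.not_ge)
          ENNReal.ofReal_ne_top, hA0] at this
      simp only [enorm_indicator_eq_indicator_enorm, lintegral_indicator hA] at this
      rw [ENNReal.zero_rpow_of_pos (by rw [ENNReal.toReal_ofReal hp0.le]; positivity), mul_zero,
        ENNReal.zero_rpow_of_pos hp0] at this
      simp only [mul_zero, add_zero, setLIntegral_const, Real.enorm_of_nonneg t.coe_nonneg,
        ENNReal.ofReal_coe_nnreal] at this
      rwa [← mul_assoc, mul_comm (t : ℝ≥0∞), mul_assoc]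
    by_contra hne
    have hpos : ENNReal.ofReal m * μ A ≠ 0 := mul_ne_zero hm0 hne
    obtain ⟨t, ht'⟩ := ENNReal.exists_nat_mul_gt hpos hB
    exact absurd (ht t) (not_le.2 (by simpa using ht'))
  rw [energy, if_pos hac]
  set ρ := μ.rnDeriv (volume : Measure (Rd d)) with hρ
  have hρm : Measurable ρ := Measure.measurable_rnDeriv _ _
  let S : ℕ → Set (Rd d) := fun n => {x | ρ x ≤ n} ∩ Metric.closedBall 0 n
  have hS : ∀ n, MeasurableSet (S n) := fun n =>
    (measurableSet_le hρm measurable_const).inter Metric.isClosed_closedBall.measurableSet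
  have hSmono : Monotone S := by
    intro a b hab x hx
    have : (a : ℝ) ≤ b := by exact_mod_cast hab
    have hx1 : ρ x ≤ a := hx.1
    exact ⟨hx1.trans (by exact_mod_cast hab), Metric.closedBall_subset_closedBall this hx.2⟩
  have hunion : ∀ᵐ x ∂(volume : Measure (Rd d)), x ∈ ⋃ n, S n := by
    filter_upwards [Measure.rnDeriv_lt_top μ (volume : Measure (Rd d))] with x hx
    obtain ⟨n, hn⟩ := ENNReal.exists_nat_gt hx.ne
    obtain ⟨k, hk⟩ := exists_nat_ge ‖x‖
    refine Set.mem_iUnion.2 ⟨max n k, ?_, ?_⟩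
    · exact hn.le.trans (by exact_mod_cast le_max_left n k)
    · simpa using Or.inr hk
  have hbound : ∀ n, ∫⁻ x in S n, ρ x ^ m ≤ B := by
    intro n
    have hSv : volume (S n) < ⊤ :=
      (measure_mono Set.inter_subset_right).trans_lt measure_closedBall_lt_top
    have hfin : ∫⁻ x in S n, ρ x ^ m ≠ ⊤ := by
      refine ((setLIntegral_mono (g := fun _ => (n : ℝ≥0∞) ^ m) (by fun_prop)
        fun x hx => ENNReal.rpow_le_rpow hx.1 hp.pos.le).trans_lt ?_).ne
      rw [setLIntegral_const]
      exact ENNReal.mul_lt_top (ENNReal.rpow_lt_top_of_nonneg hp.pos.le (by simp)) hSv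
    let ψ : Rd d → ℝ := (S n).indicator fun x => (ρ x).toReal ^ (m - 1)
    have hψm : Measurable ψ := Measurable.indicator (by fun_prop) (hS n)
    have hm1 : 0 ≤ m - 1 := hp.sub_one_pos.le
    have hen : ∀ x, ‖ψ x‖ₑ = (S n).indicator (fun x => ρ x ^ (m - 1)) x := by
      intro x
      by_cases hx : x ∈ S n
      · have hxt : ρ x ≠ ⊤ := ne_top_of_le_ne_top (by simp) hx.1
        simp only [ψ, Set.indicator_of_mem hx]
        rw [Real.enorm_of_nonneg (by positivity),
          ← ENNReal.ofReal_rpow_of_nonneg ENNReal.toReal_nonneg hm1, ENNReal.ofReal_toReal hxt]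
      · simp [ψ, hx]
    have hmem : MemLp ψ (ENNReal.ofReal p) (μ + volume) := by
      rw [memLp_indicator_iff_restrict (hS n)]
      have : IsFiniteMeasure ((μ + volume).restrict (S n)) :=
        ⟨by simpa using hSv⟩
      refine MemLp.of_bound (Measurable.aestronglyMeasurable (by fun_prop))
        ((n : ℝ) ^ (m - 1)) ?_
      refine ae_restrict_of_forall_mem (hS n) fun x hx => ?_
      rw [Real.norm_of_nonneg (by positivity)]
      refine Real.rpow_le_rpow ENNReal.toReal_nonneg ?_ hm1
      simpa using ENNReal.toReal_mono (by simp) hx.1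
    have h1 : eLpNorm ψ 1 μ = ∫⁻ x in S n, ρ x ^ m := by
      rw [eLpNorm_one_eq_lintegral_enorm, ← lintegral_rnDeriv_mul hac (by fun_prop),
        ← lintegral_indicator (hS n)]
      refine lintegral_congr fun x => ?_
      rw [hen]
      by_cases hx : x ∈ S n
      · simp only [Set.indicator_of_mem hx]
        conv_lhs => rw [← hρ, ← ENNReal.rpow_one (ρ x), ← ENNReal.rpow_mul, one_mul,
          ← ENNReal.rpow_add_of_nonneg _ _ zero_le_one hm1]
        congr 1; ring
      · simp [hx]
    have h2 : eLpNorm ψ (ENNReal.ofReal p) volume ^ p = ∫⁻ x in S n, ρ x ^ m := by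
      rw [eLpNorm_eq_lintegral_rpow_enorm_toReal (by simpa using hp0) ENNReal.ofReal_ne_top,
        ENNReal.toReal_ofReal hp0.le, ← ENNReal.rpow_mul, one_div, inv_mul_cancel₀ hp0.ne',
        ENNReal.rpow_one, ← lintegral_indicator (hS n)]
      refine lintegral_congr fun x => ?_
      rw [hen]
      by_cases hx : x ∈ S n
      · simp only [Set.indicator_of_mem hx]
        rw [← ENNReal.rpow_mul, hp.sub_one_mul_conj]
      · simp [hx, hp0]
    have := hext ψ hmem
    rw [h1, h2] at this
    have hM : ENNReal.ofReal m = 1 + ENNReal.ofReal (m - 1) := by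
      rw [← ENNReal.ofReal_one, ← ENNReal.ofReal_add zero_le_one hm1]
      congr 1; ring
    rw [hM, add_mul, one_mul] at this
    exact (ENNReal.add_le_add_iff_right
      (ENNReal.mul_ne_top ENNReal.ofReal_ne_top hfin)).1 this
  calc ∫⁻ x, ρ x ^ m = ∫⁻ x in ⋃ n, S n, ρ x ^ m := by
        rw [Measure.restrict_eq_self_of_ae_mem hunion]
    _ = ⨆ n, ∫⁻ x in S n, ρ x ^ m :=
        setLIntegral_iUnion_of_directed _ hSmono.directed_le
    _ ≤ B := iSup_le hbound

/-- The energy is lower semicontinuous with respect to narrow convergence. -/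
lemma energy_le_liminf {d : ℕ} {m : ℝ} (hm : 1 < m) {μ : ℕ → Measure (Rd d)}
    {μlim : Measure (Rd d)} [∀ k, IsProbabilityMeasure (μ k)] [IsProbabilityMeasure μlim]
    (h : NarrowTendsto μ μlim) :
    energy m μlim ≤ liminf (fun k => energy m (μ k)) atTop := by
  have hp := Real.HolderConjugate.conjExponent hm
  set p := m.conjExponent
  have hp0 : 0 < p := hp.symm.pos
  refine energy_le_of_forall_continuous hp μlim fun φ hφ hφs => ?_
  obtain ⟨C, hC⟩ := hφs.exists_bound_of_continuous hφ
  let f : Rd d →ᵇ ℝ := BoundedContinuousFunction.ofNormedAddCommGroup (fun x => ‖φ x‖)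
    hφ.norm C (by simpa using hC)
  have hlim := h.tendsto_lintegral f fun x => norm_nonneg (φ x)
  have hf : ∀ x, ENNReal.ofReal (f x) = ‖φ x‖ₑ := fun x => ofReal_norm (φ x)
  simp only [hf] at hlim
  have hP : eLpNorm φ (ENNReal.ofReal p) volume ^ p = ∫⁻ x, ‖φ x‖ₑ ^ p := by
    rw [eLpNorm_eq_lintegral_rpow_enorm_toReal (by simpa using hp0) ENNReal.ofReal_ne_top,
      ENNReal.toReal_ofReal hp0.le, ← ENNReal.rpow_mul, one_div, inv_mul_cancel₀ hp0.ne',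
      ENNReal.rpow_one]
  rw [eLpNorm_one_eq_lintegral_enorm, hP]
  have hlim' := ENNReal.Tendsto.const_mul (a := ENNReal.ofReal m) hlim
    (Or.inr ENNReal.ofReal_ne_top)
  have hfin : ENNReal.ofReal (m - 1) * ∫⁻ x, ‖φ x‖ₑ ^ p ≠ ⊤ := by
    refine ENNReal.mul_ne_top ENNReal.ofReal_ne_top ?_
    rw [← hP]
    exact ENNReal.rpow_ne_top_of_nonneg hp0.le
      (hφ.memLp_of_hasCompactSupport hφs).eLpNorm_ne_top
  rw [← tsub_le_iff_right]
  rw [← (ENNReal.Tendsto.sub hlim' tendsto_const_nhds (Or.inr hfin)).liminf_eq]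
  refine liminf_le_liminf (Eventually.of_forall fun k => ?_)
  rw [tsub_le_iff_right]
  exact mul_lintegral_le_energy_add hp (μ k) hφ.enorm.measurable

/-- Quadratic coercivity of the approximate costs. -/
lemma ApproxCost.sq_norm_le {d : ℕ} {Cf : CostFn d} {τ α : ℝ} (hτ : 0 < τ)
    (hα : 0 < α ∧ α < 1) {c : Rd2 d → ℝ≥0∞} (hc : ApproxCost Cf τ α c) (p : Rd2 d) :
    (‖p.2‖₊ : ℝ≥0∞) ^ 2 ≤
      2 * (‖p.1‖₊ : ℝ≥0∞) ^ 2 + ENNReal.ofReal (4 * τ ^ 2) + 4 * c p := by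
  have hconv : ∀ x : Rd d, (‖x‖₊ : ℝ≥0∞) ^ 2 = ENNReal.ofReal (‖x‖ ^ 2) := fun x => by
    rw [ENNReal.ofReal_pow (norm_nonneg _), ofReal_norm]; rfl
  have htri : ‖p.2‖ ≤ ‖p.1‖ + dist p.1 p.2 := by
    rw [dist_eq_norm']
    calc ‖p.2‖ = ‖p.1 + (p.2 - p.1)‖ := by simp
      _ ≤ _ := norm_add_le _ _
  have hr : 0 ≤ dist p.1 p.2 := dist_nonneg
  have hx := norm_nonneg p.1
  have hy := norm_nonneg p.2
  have key : ‖p.2‖ ^ 2 ≤ 2 * ‖p.1‖ ^ 2 + 2 * dist p.1 p.2 ^ 2 := by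
    nlinarith [sq_nonneg (‖p.1‖ - dist p.1 p.2)]
  have hfour : ∀ a : ℝ≥0∞, 4 * a = ENNReal.ofReal 4 * a := fun a => by simp
  have htwo : ∀ a : ℝ≥0∞, 2 * a = ENNReal.ofReal 2 * a := fun a => by simp
  rw [hconv, hconv, htwo, ← ENNReal.ofReal_mul (by norm_num),
    ← ENNReal.ofReal_add (by positivity) (by positivity)]
  rcases le_or_gt (dist p.1 p.2) τ with h | h
  · refine le_add_right (ENNReal.ofReal_le_ofReal ?_)
    nlinarith
  · refine le_trans ?_ (add_le_add_right (mul_le_mul_right (hc.2.2 p h) 4) _)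
    have hs : (dist p.1 p.2 - τ) ^ 2 ≤ (dist p.1 p.2 - τ) ^ 2 / α := by
      rw [le_div_iff₀ hα.1]
      nlinarith [sq_nonneg (dist p.1 p.2 - τ)]
    have h0 : 0 ≤ 1 - α + (dist p.1 p.2 - τ) ^ 2 / α := by
      nlinarith [sq_nonneg (dist p.1 p.2 - τ)]
    rw [hfour, ← ENNReal.ofReal_mul (by norm_num),
      ← ENNReal.ofReal_add (by positivity) (by positivity)]
    refine ENNReal.ofReal_le_ofReal ?_
    nlinarith [sq_nonneg (dist p.1 p.2 - 2 * τ)]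

/-- The second moment of a plan is controlled by that of its first marginal and by its cost. -/
lemma ApproxCost.pairSecondMoment_le {d : ℕ} {Cf : CostFn d} {τ α : ℝ} (hτ : 0 < τ)
    (hα : 0 < α ∧ α < 1) {c : Rd2 d → ℝ≥0∞} (hc : ApproxCost Cf τ α c) (γ : Measure (Rd2 d))
    [IsProbabilityMeasure γ] :
    pairSecondMoment γ ≤ 3 * secondMoment (γ.map Prod.fst) + ENNReal.ofReal (4 * τ ^ 2)
      + 4 * costIntegral c γ := by
  have hcm := hc.1
  have h1 : secondMoment (γ.map Prod.fst) = ∫⁻ p, (‖p.1‖₊ : ℝ≥0∞) ^ 2 ∂γ := by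
    rw [secondMoment, lintegral_map (by fun_prop) measurable_fst]
  calc pairSecondMoment γ
      ≤ ∫⁻ p, (3 * (‖p.1‖₊ : ℝ≥0∞) ^ 2 + ENNReal.ofReal (4 * τ ^ 2) + 4 * c p) ∂γ := by
        refine lintegral_mono fun p => ?_
        calc (‖p.1‖₊ : ℝ≥0∞) ^ 2 + (‖p.2‖₊ : ℝ≥0∞) ^ 2
            ≤ (‖p.1‖₊ : ℝ≥0∞) ^ 2 + (2 * (‖p.1‖₊ : ℝ≥0∞) ^ 2
              + ENNReal.ofReal (4 * τ ^ 2) + 4 * c p) := by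
              gcongr; exact hc.sq_norm_le hτ hα p
          _ = _ := by ring
    _ = _ := by
        rw [lintegral_add_left (by fun_prop), lintegral_add_left (by fun_prop),
          lintegral_const_mul _ (by fun_prop), lintegral_const_mul _ hcm, h1, lintegral_const]
        simp [costIntegral]

/-- Elementary bound for the negative part of `t log t`. -/
lemma neg_mul_log_le {t : ℝ} (ht : 0 ≤ t) (b : ℝ) :
    -(t * Real.log t) ≤ b * t + Real.exp (-b) := by
  rcases ht.eq_or_lt with rfl | ht
  · simpa using (Real.exp_pos _).le
  have h := Real.log_le_sub_one_of_pos (x := Real.exp (-b) / t) (by positivity)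
  rw [Real.log_div (Real.exp_pos _).ne' ht.ne', Real.log_exp] at h
  have h2 := mul_le_mul_of_nonneg_left h ht.le
  have h3 : t * (Real.exp (-b) / t - 1) = Real.exp (-b) - t := by field_simp
  rw [h3] at h2
  linarith

/-- Gaussian functions are integrable on `ℝ^d × ℝ^d`. -/
lemma integrable_exp_neg_sq_add_sq (d : ℕ) :
    Integrable (fun p : Rd2 d => Real.exp (-(‖p.1‖ ^ 2 + ‖p.2‖ ^ 2)))
      (volume : Measure (Rd2 d)) := by
  have h : Integrable (fun x : Rd d => Real.exp (-‖x‖ ^ 2)) volume := by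
    have := (GaussianFourier.integrable_cexp_neg_mul_sq_norm_add (V := Rd d) (b := 1)
      (by simp) 0 0).norm
    refine this.congr (ae_of_all _ fun x => ?_)
    simp only [Complex.norm_exp]
    congr 1
    simp [← Complex.ofReal_pow]
  refine (h.mul_prod h).congr (ae_of_all _ fun p => ?_)
  simp only
  rw [← Real.exp_add]
  congr 1; ring

/-- The negative part of the entropy of a plan is controlled by its second moment. -/
lemma neg_le_entropy {d : ℕ} (γ : Measure (Rd2 d)) [IsFiniteMeasure γ] {R : ℝ}
    (hR : pairSecondMoment γ + ∫⁻ p : Rd2 d, ENNReal.ofReal (Real.exp (-(‖p.1‖ ^ 2 + ‖p.2‖ ^ 2)))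
      ≤ ENNReal.ofReal R) (hR0 : 0 ≤ R) :
    ((-R : ℝ) : EReal) ≤ entropy (volume : Measure (Rd2 d)) γ := by
  unfold entropy
  split_ifs with hac
  swap
  · exact le_top
  have hN : ∫⁻ x, ENNReal.ofReal (-((γ.rnDeriv volume x).toReal *
      Real.log (γ.rnDeriv volume x).toReal)) ∂(volume : Measure (Rd2 d)) ≤ ENNReal.ofReal R := by
    refine le_trans ?_ hR
    have hM : pairSecondMoment γ = ∫⁻ p, γ.rnDeriv volume p *
        ((‖p.1‖₊ : ℝ≥0∞) ^ 2 + (‖p.2‖₊ : ℝ≥0∞) ^ 2) := by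
      rw [lintegral_rnDeriv_mul hac (by fun_prop), pairSecondMoment]
    rw [hM, ← lintegral_add_left (by fun_prop)]
    refine lintegral_mono_ae ?_
    filter_upwards [Measure.rnDeriv_lt_top γ (volume : Measure (Rd2 d))] with p hp
    refine (ENNReal.ofReal_le_ofReal (neg_mul_log_le ENNReal.toReal_nonneg
      (‖p.1‖ ^ 2 + ‖p.2‖ ^ 2))).trans ?_
    refine ENNReal.ofReal_add_le.trans ?_
    gcongr
    rw [mul_comm, ENNReal.ofReal_mul ENNReal.toReal_nonneg, ENNReal.ofReal_toReal hp.ne,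
      ENNReal.ofReal_add (by positivity) (by positivity),
      ENNReal.ofReal_pow (norm_nonneg _), ENNReal.ofReal_pow (norm_nonneg _), ofReal_norm,
      ofReal_norm]
    rfl
  set N := ∫⁻ x, ENNReal.ofReal (-((γ.rnDeriv volume x).toReal *
      Real.log (γ.rnDeriv volume x).toReal)) ∂(volume : Measure (Rd2 d))
  set Q := ∫⁻ x, ENNReal.ofReal ((γ.rnDeriv volume x).toReal *
      Real.log (γ.rnDeriv volume x).toReal) ∂(volume : Measure (Rd2 d))
  have hN' : ((N : ℝ≥0∞) : EReal) ≤ (R : EReal) := by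
    have := EReal.coe_ennreal_le_coe_ennreal_iff.2 hN
    rwa [EReal.coe_ennreal_ofReal, max_eq_left hR0] at this
  have hQ : (0 : EReal) ≤ ((Q : ℝ≥0∞) : EReal) := EReal.coe_ennreal_nonneg _
  calc ((-R : ℝ) : EReal) = 0 - (R : EReal) := by simp
    _ ≤ _ := EReal.sub_le_sub hQ hN'

/-- The transport cost is lower semicontinuous along narrowly convergent plans and
approximating costs. -/
lemma costIntegral_le_liminf {d : ℕ} (Cf : CostFn d) {τ : ℝ} (hτ : 0 < τ) {α : ℕ → ℝ}
    (hα : ∀ k, 0 < α k) (hαlim : Tendsto α atTop (𝓝 0))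
    {c : ℕ → Rd2 d → ℝ≥0∞} (hc : ∀ k, ApproxCost Cf τ (α k) (c k))
    {γ : ℕ → Measure (Rd2 d)} {γlim : Measure (Rd2 d)} [∀ k, IsProbabilityMeasure (γ k)]
    [IsProbabilityMeasure γlim] (h : NarrowTendsto γ γlim) :
    costIntegral (cCost Cf τ) γlim ≤ liminf (fun k => costIntegral (c k) (γ k)) atTop := by
  let proj : Rd d → Rd d := fun v => (max 1 ‖v‖)⁻¹ • v
  have hmax : ∀ v : Rd d, 0 < max 1 ‖v‖ := fun v => lt_max_of_lt_left one_pos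
  have hprojc : Continuous proj := by
    refine Continuous.smul (Continuous.inv₀ (by fun_prop) fun v => (hmax v).ne') continuous_id
  have hproj : ∀ v, proj v ∈ Metric.closedBall (0 : Rd d) 1 := by
    intro v
    rw [mem_closedBall_zero_iff, norm_smul, norm_inv, Real.norm_of_nonneg (hmax v).le,
      inv_mul_le_iff₀ (hmax v), mul_one]
    exact le_max_right _ _
  have hprojin : ∀ v, ‖v‖ ≤ 1 → proj v = v := fun v hv => by simp [proj, max_eq_left hv]
  have hprojout : ∀ v, 1 < ‖v‖ → ‖proj v‖ = 1 := by
    intro v hv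
    have : ‖v‖ ≠ 0 := by linarith
    simp [proj, max_eq_right hv.le, norm_smul, this]
  obtain ⟨K, hK⟩ := (isCompact_closedBall (0 : Rd d) 1).exists_bound_of_continuousOn
    Cf.continuousOn
  let g : Rd2 d → ℝ := fun p => Cf.C0 (proj (τ⁻¹ • (p.2 - p.1)))
  let s : Rd2 d → ℝ := fun p => min 1 ((max (dist p.1 p.2 - τ) 0) ^ 2)
  have hg0 : ∀ p, 0 ≤ g p := fun p => Cf.nonneg _
  have hs0 : ∀ p, 0 ≤ s p := fun p => by positivity
  have hgc : Continuous g :=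
    Cf.continuousOn.comp_continuous (hprojc.comp (by fun_prop)) fun p => hproj _
  have hsc : Continuous s := by fun_prop
  have hnorm : ∀ p : Rd2 d, ‖τ⁻¹ • (p.2 - p.1)‖ = dist p.1 p.2 / τ := by
    intro p
    rw [norm_smul, dist_eq_norm', norm_inv, Real.norm_of_nonneg hτ.le]
    ring
  have hin : ∀ p : Rd2 d, dist p.1 p.2 ≤ τ →
      s p = 0 ∧ cCost Cf τ p = ENNReal.ofReal (g p) := by
    intro p hp
    have hle : ‖τ⁻¹ • (p.2 - p.1)‖ ≤ 1 := by rw [hnorm, div_le_one hτ]; exact hp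
    refine ⟨by simp [s, max_eq_right (sub_nonpos.2 hp)], ?_⟩
    simp only [g, cCost, hprojin _ hle, Cf.eq_inside _ hle]
  have hout : ∀ p : Rd2 d, τ < dist p.1 p.2 →
      0 < s p ∧ s p ≤ (dist p.1 p.2 - τ) ^ 2 ∧ g p = 1 := by
    intro p hp
    have hlt : 1 < ‖τ⁻¹ • (p.2 - p.1)‖ := by rw [hnorm, one_lt_div hτ]; exact hp
    have hpos : 0 < dist p.1 p.2 - τ := sub_pos.2 hp
    have hseq : s p = min 1 ((dist p.1 p.2 - τ) ^ 2) := by simp only [s, max_eq_left hpos.le]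
    refine ⟨by rw [hseq]; positivity, by rw [hseq]; exact min_le_right _ _, ?_⟩
    exact Cf.boundary _ (hprojout _ hlt)
  let f : ℕ → (Rd2 d →ᵇ ℝ) := fun n =>
    BoundedContinuousFunction.ofNormedAddCommGroup (fun p => g p + n * s p)
      (hgc.add (continuous_const.mul hsc)) (K + n) (by
        intro p
        rw [Real.norm_of_nonneg (add_nonneg (hg0 p) (mul_nonneg n.cast_nonneg (hs0 p)))]
        have h1 : g p ≤ K := (le_abs_self _).trans (hK _ (hproj _))
        have h2 : n * s p ≤ n * 1 :=
          mul_le_mul_of_nonneg_left (min_le_left _ _) n.cast_nonneg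
        linarith)
  have hf : ∀ n p, f n p = g p + n * s p := fun n p => rfl
  have hf0 : ∀ n p, 0 ≤ f n p := fun n p =>
    add_nonneg (hg0 p) (mul_nonneg n.cast_nonneg (hs0 p))
  have hlower : ∀ n, ∀ᶠ k in atTop, ∀ p,
      ENNReal.ofReal (f n p) ≤ c k p + ENNReal.ofReal (α k) := by
    intro n
    have hev : ∀ᶠ k in atTop, α k < 1 / ((n : ℝ) + 1) :=
      hαlim.eventually_lt_const (by positivity)
    filter_upwards [hev] with k hk p
    rw [hf]
    rcases le_or_gt (dist p.1 p.2) τ with hp | hp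
    · obtain ⟨h1, h2⟩ := hin p hp
      rw [h1, mul_zero, add_zero, ← h2]
      exact ((hc k).2.1 p hp).2
    · obtain ⟨h1, h2, h3⟩ := hout p hp
      refine le_trans ?_ (add_le_add_left ((hc k).2.2 p hp) _)
      refine le_trans (ENNReal.ofReal_le_ofReal ?_) ENNReal.ofReal_add_le
      rw [h3]
      have : n * s p ≤ (dist p.1 p.2 - τ) ^ 2 / α k := by
        rw [le_div_iff₀ (hα k)]
        rw [lt_div_iff₀ (by positivity)] at hk
        have hn : (n : ℝ) * α k ≤ 1 := by nlinarith [hα k]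
        nlinarith
      linarith
  have hle : ∀ n, ∫⁻ p, ENNReal.ofReal (f n p) ∂γlim ≤
      liminf (fun k => costIntegral (c k) (γ k)) atTop := by
    intro n
    have hlim := ENNReal.Tendsto.sub (h.tendsto_lintegral (f n) (hf0 n))
      (ENNReal.tendsto_ofReal hαlim) (Or.inr (by simp))
    rw [ENNReal.ofReal_zero, tsub_zero] at hlim
    rw [← hlim.liminf_eq]
    refine liminf_le_liminf ?_
    filter_upwards [hlower n] with k hk
    rw [tsub_le_iff_right]
    calc ∫⁻ p, ENNReal.ofReal (f n p) ∂(γ k)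
        ≤ ∫⁻ p, (c k p + ENNReal.ofReal (α k)) ∂(γ k) := lintegral_mono hk
      _ = _ := by
        rw [lintegral_add_left (hc k).1, lintegral_const]
        simp [costIntegral]
  have hsup : ∀ p, cCost Cf τ p ≤ ⨆ n, ENNReal.ofReal (f n p) := by
    intro p
    rcases le_or_gt (dist p.1 p.2) τ with hp | hp
    · obtain ⟨h1, h2⟩ := hin p hp
      refine le_iSup_of_le 0 ?_
      rw [hf, h1, h2]
      simp
    · obtain ⟨h1, -, -⟩ := hout p hp
      refine le_of_le_of_eq le_top (Eq.symm ?_)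
      refine ENNReal.eq_top_of_forall_nnreal_le fun r => ?_
      obtain ⟨n, hn⟩ := exists_nat_ge (r / s p)
      refine le_iSup_of_le n ?_
      rw [← ENNReal.ofReal_coe_nnreal]
      refine ENNReal.ofReal_le_ofReal ?_
      rw [hf]
      rw [div_le_iff₀ h1] at hn
      linarith [hg0 p]
  calc costIntegral (cCost Cf τ) γlim
      ≤ ∫⁻ p, ⨆ n, ENNReal.ofReal (f n p) ∂γlim := lintegral_mono hsup
    _ = ⨆ n, ∫⁻ p, ENNReal.ofReal (f n p) ∂γlim := by
        refine lintegral_iSup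
          (fun n => ENNReal.measurable_ofReal.comp (f n).continuous.measurable) ?_
        intro a b hab p
        refine ENNReal.ofReal_le_ofReal ?_
        rw [hf, hf]
        have : (a : ℝ) ≤ b := by exact_mod_cast hab
        nlinarith [hs0 p]
    _ ≤ _ := iSup_le hle

/-- Lower bound for the regularized functional in which the entropy is absorbed by the cost. -/
lemma le_cost_add_entropy_add {d : ℕ} {Cf : CostFn d} {τ α : ℝ} (hτ : 0 < τ)
    (hα : 0 < α ∧ α < 1) {c : Rd2 d → ℝ≥0∞} (hc : ApproxCost Cf τ α c) (γ : Measure (Rd2 d))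
    [IsProbabilityMeasure γ] (hγ : pairSecondMoment γ ≠ ⊤) {R : ℝ} (hR0 : 0 ≤ R)
    (hR : 3 * secondMoment (γ.map Prod.fst) + ENNReal.ofReal (4 * τ ^ 2) +
      ∫⁻ p : Rd2 d, ENNReal.ofReal (Real.exp (-(‖p.1‖ ^ 2 + ‖p.2‖ ^ 2))) ≤ ENNReal.ofReal R)
    {ε : ℝ} (hε0 : 0 ≤ ε) (hε1 : 4 * ε ≤ 1) {b : ℝ} (w : ℝ≥0∞)
    (hb : ENNReal.ofReal b ≤ costIntegral c γ + w) :
    (((1 - 4 * ε) * b - ε * R : ℝ) : EReal) ≤ ((costIntegral c γ : ℝ≥0∞) : EReal)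
      + (ε : EReal) * entropy (volume : Measure (Rd2 d)) γ + (w : EReal) := by
  set G := ∫⁻ p : Rd2 d, ENNReal.ofReal (Real.exp (-(‖p.1‖ ^ 2 + ‖p.2‖ ^ 2)))
  have hG : G ≠ ⊤ := ne_top_of_le_ne_top ENNReal.ofReal_ne_top (le_add_self.trans hR)
  have hent : ∀ Q : ℝ, 0 ≤ Q → pairSecondMoment γ + G ≤ ENNReal.ofReal Q →
      ((ε * (-Q) : ℝ) : EReal) ≤ (ε : EReal) * entropy (volume : Measure (Rd2 d)) γ := by
    intro Q hQ0 hQ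
    rw [EReal.coe_mul]
    exact mul_le_mul_of_nonneg_left (neg_le_entropy γ hQ hQ0) (EReal.coe_nonneg.2 hε0)
  have hw : (0 : EReal) ≤ (w : EReal) := EReal.coe_ennreal_nonneg _
  rcases eq_or_ne (costIntegral c γ) ⊤ with htop | hfin
  · have h1 := hent (pairSecondMoment γ + G).toReal ENNReal.toReal_nonneg
      (ENNReal.ofReal_toReal (ENNReal.add_ne_top.2 ⟨hγ, hG⟩)).ge
    rw [htop, EReal.coe_ennreal_top,
      EReal.top_add_of_ne_bot (ne_bot_of_le_ne_bot (EReal.coe_ne_bot _) h1),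
      EReal.top_add_of_ne_bot (ne_bot_of_le_ne_bot EReal.zero_ne_bot hw)]
    exact le_top
  obtain ⟨t, ht⟩ : ∃ t : ℝ≥0, (t : ℝ≥0∞) = costIntegral c γ :=
    ⟨_, ENNReal.coe_toNNReal hfin⟩
  have hM := hc.pairSecondMoment_le hτ hα γ
  rw [← ht] at hM hb ⊢
  have h1 := hent (R + 4 * t) (by positivity) (by
    calc pairSecondMoment γ + G
        ≤ 3 * secondMoment (γ.map Prod.fst) + ENNReal.ofReal (4 * τ ^ 2) + 4 * t + G := by gcongr
      _ = (3 * secondMoment (γ.map Prod.fst) + ENNReal.ofReal (4 * τ ^ 2) + G) + 4 * t := by ring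
      _ ≤ ENNReal.ofReal R + 4 * t := by gcongr
      _ = _ := by
        rw [ENNReal.ofReal_add hR0 (by positivity), ENNReal.ofReal_mul (by norm_num)]
        simp)
  have h2 : (((t : ℝ) + ε * (-(R + 4 * t)) : ℝ) : EReal) ≤ ((t : ℝ≥0∞) : EReal)
      + (ε : EReal) * entropy (volume : Measure (Rd2 d)) γ := by
    rw [EReal.coe_add]
    exact add_le_add le_rfl h1
  refine le_trans ?_ (add_le_add h2 le_rfl)
  rcases eq_or_ne w ⊤ with rfl | hwfin
  · rw [EReal.coe_ennreal_top, EReal.coe_add_top]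
    exact le_top
  lift w to ℝ≥0 using hwfin with u
  have hb' : b ≤ t + u := by
    rw [← ENNReal.coe_add, ← ENNReal.ofReal_coe_nnreal,
      ENNReal.ofReal_le_ofReal_iff (by positivity)] at hb
    exact_mod_cast hb
  change _ ≤ (((t : ℝ) + ε * (-(R + 4 * t)) : ℝ) : EReal) + ((u : ℝ) : EReal)
  rw [← EReal.coe_add]
  refine EReal.coe_le_coe_iff.2 ?_
  have hu : (0 : ℝ) ≤ u := u.coe_nonneg
  nlinarith

/-- Liminf inequality: under the standing hypotheses, if `γ_k ∈ Γ(ρ_k)`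
converge narrowly to `γ_* ∈ Γ(ρ_*)`, then `E^τ_*(γ_*) ≤ liminf_k E^τ_k(γ_k)`. -/
theorem statement5 (d : ℕ) (hd : 1 ≤ d) (m : ℝ) (hm : 1 < m) (τ : ℝ) (hτ : 0 < τ)
    (Cf : CostFn d) (rlow : ℝ) (hrlow : 0 < rlow)
    (ε δ α : ℕ → ℝ) (hε0 : ∀ k, 0 ≤ ε k) (hδ0 : ∀ k, 0 ≤ δ k)
    (hεlim : Tendsto ε atTop (𝓝 0)) (hδlim : Tendsto δ atTop (𝓝 0))
    (𝒯 : ∀ k, 0 < δ k → Tesselation d (δ k) rlow)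
    (hα : ∀ k, 0 < α k ∧ α k < 1) (hαlim : Tendsto α atTop (𝓝 0))
    (c : ℕ → Rd2 d → ℝ≥0∞) (hc : ∀ k, ApproxCost Cf τ (α k) (c k))
    (Pδ : ℕ → Measure (Rd d) → Prop)
    (hPδ : ∀ k μ, Pδ k μ ↔ ∀ h : 0 < δ k, IsPiecewiseConstProb (𝒯 k h).cells μ)
    (ρs : ℕ → Measure (Rd d))
    (hρs : ∀ k, IsProbabilityMeasure (ρs k) ∧ ρs k ≪ (volume : Measure (Rd d)) ∧
      secondMoment (ρs k) ≠ ⊤)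
    (ρstar : Measure (Rd d))
    (hρstar : IsProbabilityMeasure ρstar ∧ ρstar ≪ (volume : Measure (Rd d)) ∧
      secondMoment ρstar ≠ ⊤)
    (hW2 : W2Tendsto ρs ρstar)
    (hEbdd : ∃ B : ℝ≥0∞, B ≠ ⊤ ∧ ∀ k, energy m (ρs k) ≤ B)
    (γs : ℕ → Measure (Rd2 d)) (γstar : Measure (Rd2 d))
    (hγs : ∀ k, IsProbabilityMeasure (γs k) ∧ (γs k).map Prod.fst = ρs k ∧
      pairSecondMoment (γs k) ≠ ⊤)
    (hγstar : IsProbabilityMeasure γstar ∧ γstar.map Prod.fst = ρstar ∧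
      pairSecondMoment γstar ≠ ⊤)
    (hnarrow : NarrowTendsto γs γstar) :
    JKOlimitPlanFun Cf τ m ρstar γstar ≤
      Filter.liminf (fun k => JKOfun τ (ε k) m (Pδ k) (c k) (ρs k) (γs k)) atTop := by
  have := fun k => (hγs k).1
  have := hγstar.1
  have hτ' : (0 : ℝ) ≤ 1 / τ := by positivity
  set κ := ENNReal.ofReal (1 / τ)
  have hκ : ((1 / τ : ℝ) : EReal) = (κ : EReal) := by
    rw [EReal.coe_ennreal_ofReal, max_eq_left hτ']
  have hcost := costIntegral_le_liminf Cf hτ (fun k => (hα k).1) hαlim hc hnarrow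
  have := fun k => Measure.isProbabilityMeasure_map (μ := γs k)
    (f := Prod.snd) measurable_snd.aemeasurable
  have := Measure.isProbabilityMeasure_map (μ := γstar)
    (f := Prod.snd) measurable_snd.aemeasurable
  have hen := energy_le_liminf hm (hnarrow.map (g := Prod.snd) continuous_snd)
  let A : ℕ → ℝ≥0∞ := fun k => costIntegral (c k) (γs k) + κ * energy m ((γs k).map Prod.snd)
  set A' := costIntegral (cCost Cf τ) γstar + κ * energy m (γstar.map Prod.snd)
  have hA : A' ≤ liminf A atTop := by
    refine le_trans ?_ (ENNReal.liminf_add_liminf_le _ _)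
    refine add_le_add hcost ?_
    rw [ENNReal.liminf_const_mul_of_ne_top ENNReal.ofReal_ne_top]
    gcongr
  obtain ⟨R, hR0, hR⟩ : ∃ R : ℝ, 0 ≤ R ∧ 3 * (secondMoment ρstar + 1) +
      ENNReal.ofReal (4 * τ ^ 2) + ∫⁻ p : Rd2 d,
        ENNReal.ofReal (Real.exp (-(‖p.1‖ ^ 2 + ‖p.2‖ ^ 2))) = ENNReal.ofReal R := by
    refine ⟨_, ENNReal.toReal_nonneg, (ENNReal.ofReal_toReal ?_).symm⟩
    refine ENNReal.add_ne_top.2 ⟨ENNReal.add_ne_top.2 ⟨ENNReal.mul_ne_top (by simp)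
      (ENNReal.add_ne_top.2 ⟨hρstar.2.2, by simp⟩), ENNReal.ofReal_ne_top⟩, ?_⟩
    exact (integrable_exp_neg_sq_add_sq d).lintegral_lt_top.ne
  have hmom : ∀ᶠ k in atTop, secondMoment (ρs k) < secondMoment ρstar + 1 :=
    hW2.2.eventually_lt_const (ENNReal.lt_add_right hρstar.2.2 one_ne_zero)
  rw [JKOlimitPlanFun, if_pos hγstar.2.1, hκ, ← EReal.coe_ennreal_mul, ← EReal.coe_ennreal_add]
  change (A' : EReal) ≤ _
  rw [le_liminf_iff']
  intro y hy
  obtain ⟨x, hyx, hxA⟩ := EReal.lt_iff_exists_real_btwn.1 hy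
  have hxk : ∀ᶠ k in atTop, ENNReal.ofReal x ≤ A k := by
    rcases le_or_gt x 0 with hx | hx
    · simp [ENNReal.ofReal_of_nonpos hx]
    · have hlt : ENNReal.ofReal x < A' := by
        rwa [← EReal.coe_ennreal_lt_coe_ennreal_iff, EReal.coe_ennreal_ofReal,
          max_eq_left hx.le]
      exact (eventually_lt_of_lt_liminf (hlt.trans_le hA)).mono fun k hk => hk.le
  have hlow : Tendsto (fun k => (((1 - 4 * ε k) * x - ε k * R : ℝ) : EReal)) atTop
      (𝓝 (x : EReal)) := by
    refine (continuous_coe_real_ereal.tendsto x).comp ?_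
    have := (((hεlim.const_mul 4).const_sub 1).mul_const x).sub (hεlim.mul_const R)
    simpa using this
  have hε4 : ∀ᶠ k in atTop, ε k < 1 / 4 := hεlim.eventually_lt_const (by norm_num)
  filter_upwards [hmom, hxk, hlow.eventually_const_lt hyx, hε4] with k hk1 hk2 hk3 hk4
  unfold JKOfun
  split_ifs
  swap
  · exact le_top
  refine hk3.le.trans ?_
  rw [hκ, ← EReal.coe_ennreal_mul]
  refine le_cost_add_entropy_add hτ (hα k) (hc k) (γs k) (hγs k).2.2 hR0 ?_ (hε0 k)
    (by linarith) _ hk2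
  rw [← hR, (hγs k).2.1]
  gcongr
end
end

section
/- Let τ > 0 and let (α_k) ⊂ (0,1) with α_k → 0, and let c_k : ℝ^d×ℝ^d → [0,∞] be measurable costs with c_k(x,y) ≥ 1 − α_k + (|y−x| − τ)²/α_k whenever |x−y| > τ. If probability measures γ_k on ℝ^d×ℝ^d converge narrowly to γ_* and sup_k ∬ c_k dγ_k < ∞, then γ_* is supported in the set {(x,y) : |x−y| ≤ τ}. -/
open MeasureTheory Filter Topology BoundedContinuousFunction
open scoped ENNReal NNReal

noncomputable section
open scoped Classical

/-- The test function `min 1 (max 0 (|x - y| - τ))²`, which is positive exactly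
on `{|x - y| > τ}`. -/
def truncatedExcessSq (d : ℕ) (τ : ℝ) : Rd2 d →ᵇ ℝ :=
  BoundedContinuousFunction.ofNormedAddCommGroup
    (fun p => min 1 ((max 0 (dist p.1 p.2 - τ)) ^ 2)) (by fun_prop) 1 (fun p => by
      rw [Real.norm_of_nonneg (by positivity)]
      exact min_le_left _ _)

theorem truncatedExcessSq_apply {d : ℕ} (τ : ℝ) (p : Rd2 d) :
    truncatedExcessSq d τ p = min 1 ((max 0 (dist p.1 p.2 - τ)) ^ 2) :=
  rfl

theorem truncatedExcessSq_nonneg {d : ℕ} (τ : ℝ) (p : Rd2 d) :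
    0 ≤ truncatedExcessSq d τ p := by
  rw [truncatedExcessSq_apply]
  positivity

theorem truncatedExcessSq_pos {d : ℕ} {τ : ℝ} {p : Rd2 d} (hp : τ < dist p.1 p.2) :
    0 < truncatedExcessSq d τ p := by
  rw [truncatedExcessSq_apply]
  have : 0 < max 0 (dist p.1 p.2 - τ) := lt_max_of_lt_right (sub_pos.2 hp)
  positivity

theorem ofReal_truncatedExcessSq_le {d : ℕ} {τ a : ℝ} (ha : 0 < a) (ha1 : a < 1)
    {c : Rd2 d → ℝ≥0∞}
    (hc : ∀ p : Rd2 d, τ < dist p.1 p.2 →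
      ENNReal.ofReal (1 - a + (dist p.1 p.2 - τ) ^ 2 / a) ≤ c p) (p : Rd2 d) :
    ENNReal.ofReal (truncatedExcessSq d τ p) ≤ ENNReal.ofReal a * c p := by
  rw [truncatedExcessSq_apply]
  rcases le_or_gt (dist p.1 p.2) τ with h | h
  · simp [max_eq_left (sub_nonpos.2 h)]
  · calc ENNReal.ofReal (min 1 ((max 0 (dist p.1 p.2 - τ)) ^ 2))
        ≤ ENNReal.ofReal (a * (1 - a + (dist p.1 p.2 - τ) ^ 2 / a)) := by
          apply ENNReal.ofReal_le_ofReal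
          rw [max_eq_right (sub_pos.2 h).le, mul_add, mul_div_cancel₀ _ ha.ne']
          have : 0 ≤ a * (1 - a) := mul_nonneg ha.le (sub_pos.2 ha1).le
          exact (min_le_right _ _).trans (le_add_of_nonneg_left this)
      _ = ENNReal.ofReal a * ENNReal.ofReal (1 - a + (dist p.1 p.2 - τ) ^ 2 / a) :=
          ENNReal.ofReal_mul ha.le
      _ ≤ ENNReal.ofReal a * c p := by gcongr; exact hc p h

theorem integral_truncatedExcessSq_le {d : ℕ} {τ a : ℝ} (ha : 0 < a) (ha1 : a < 1)
    {c : Rd2 d → ℝ≥0∞}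
    (hc : ∀ p : Rd2 d, τ < dist p.1 p.2 →
      ENNReal.ofReal (1 - a + (dist p.1 p.2 - τ) ^ 2 / a) ≤ c p)
    (γ : Measure (Rd2 d)) {B : ℝ≥0∞} (hB : B ≠ ⊤)
    (hbdd : costIntegral c γ ≤ B) :
    ∫ p, truncatedExcessSq d τ p ∂γ ≤ a * B.toReal := by
  rw [integral_eq_lintegral_of_nonneg_ae (ae_of_all _ (truncatedExcessSq_nonneg τ))
    (truncatedExcessSq d τ).continuous.aestronglyMeasurable]
  refine ENNReal.toReal_le_of_le_ofReal (by positivity) ?_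
  calc ∫⁻ p, ENNReal.ofReal (truncatedExcessSq d τ p) ∂γ
      ≤ ∫⁻ p, ENNReal.ofReal a * c p ∂γ :=
        lintegral_mono (ofReal_truncatedExcessSq_le ha ha1 hc)
    _ = ENNReal.ofReal a * costIntegral c γ := lintegral_const_mul' _ _ ENNReal.ofReal_ne_top
    _ ≤ ENNReal.ofReal a * B := by gcongr
    _ = ENNReal.ofReal (a * B.toReal) := by
        rw [ENNReal.ofReal_mul ha.le, ENNReal.ofReal_toReal hB]

/-- If costs `c_k` satisfy the quadratic lower bound outside the cylinder
`{|x−y| ≤ τ}` with constants `α_k → 0`, probability measures `γ_k → γ_*` narrowly, and the cost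
integrals `∬ c_k dγ_k` are uniformly bounded, then `γ_*` is supported in `{|x−y| ≤ τ}`, i.e.
`γ_*({|x−y| > τ}) = 0`. -/
theorem statement6 (d : ℕ) (hd : 1 ≤ d) (τ : ℝ) (hτ : 0 < τ)
    (α : ℕ → ℝ) (hα : ∀ k, 0 < α k ∧ α k < 1) (hαlim : Tendsto α atTop (𝓝 0))
    (c : ℕ → Rd2 d → ℝ≥0∞)
    (hc : ∀ k, ∀ p : Rd2 d, τ < dist p.1 p.2 →
      ENNReal.ofReal (1 - α k + (dist p.1 p.2 - τ) ^ 2 / α k) ≤ c k p)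
    (γ : ℕ → Measure (Rd2 d)) (hγ : ∀ k, IsProbabilityMeasure (γ k))
    (γstar : Measure (Rd2 d)) (hγstar : IsProbabilityMeasure γstar)
    (hnarrow : NarrowTendsto γ γstar)
    (B : ℝ≥0∞) (hB : B ≠ ⊤) (hbdd : ∀ k, costIntegral (c k) (γ k) ≤ B) :
    γstar {p : Rd2 d | τ < dist p.1 p.2} = 0 := by
  have hlim : Tendsto (fun k => ∫ p, truncatedExcessSq d τ p ∂(γ k)) atTop (𝓝 0) := by
    refine squeeze_zero (fun k => integral_nonneg (truncatedExcessSq_nonneg τ))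
      (fun k => integral_truncatedExcessSq_le (hα k).1 (hα k).2 (hc k) (γ k) hB (hbdd k)) ?_
    simpa using hαlim.mul_const B.toReal
  have hzero : ∫ p, truncatedExcessSq d τ p ∂γstar = 0 :=
    tendsto_nhds_unique (hnarrow (truncatedExcessSq d τ)) hlim
  rw [integral_eq_zero_iff_of_nonneg (truncatedExcessSq_nonneg τ)
    ((truncatedExcessSq d τ).integrable γstar)] at hzero
  exact measure_mono_null (fun p hp => (truncatedExcessSq_pos hp).ne') (ae_iff.1 hzero)
end
end

section
/- Let δ > 0 and let 𝒯 be a countable tesselation of ℝ^d into pairwise disjoint measurable cells Q with ℒ^d(Q) ≥ δ^d for each Q. Let γ be a probability measure on ℝ^d×ℝ^d whose first marginal is ρℒ^d for a probability density ρ with ∫ ρ log ρ dx well defined. For each cell Q let g^Q ∈ L¹(ℝ^d) be the Lebesgue density of the measure A ↦ γ(A×Q) (which exists since Σ_Q g^Q = ρ), and define G(x,y) := g^Q(x)/ℒ^d(Q) for y ∈ Q. Then G is a probability density on ℝ^d×ℝ^d and ∬ G log G d(x,y) ≤ ∫ ρ log ρ dx + d·log(1/δ). -/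
open MeasureTheory Filter Topology BoundedContinuousFunction
open scoped ENNReal NNReal

noncomputable section
open scoped Classical

theorem entropy_withDensity {X : Type*} [MeasurableSpace X] (vol : Measure X) [SigmaFinite vol]
    {f : X → ℝ≥0∞} (hf : Measurable f) :
    entropy vol (vol.withDensity f) =
      ((∫⁻ x, ENNReal.ofReal ((f x).toReal * Real.log (f x).toReal) ∂vol : ℝ≥0∞) : EReal)
        - ((∫⁻ x, ENNReal.ofReal (-((f x).toReal * Real.log (f x).toReal)) ∂vol : ℝ≥0∞) :
          EReal) := by
  have h := Measure.rnDeriv_withDensity vol hf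
  rw [entropy, if_pos (withDensity_absolutelyContinuous vol f)]
  congr 2
  · exact lintegral_congr_ae (by filter_upwards [h] with x hx; rw [hx])
  · exact lintegral_congr_ae (by filter_upwards [h] with x hx; rw [hx])

theorem div_mul_log_div_le {g r V a : ℝ} (hg : 0 ≤ g) (hgr : g ≤ r) (ha : 0 < a) (haV : a ≤ V) :
    g / V * Real.log (g / V) ≤ g / V * (Real.log r - Real.log a) := by
  have hV : 0 < V := ha.trans_le haV
  rcases hg.eq_or_lt with rfl | hg
  · simp
  refine mul_le_mul_of_nonneg_left ?_ (by positivity)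
  rw [Real.log_div hg.ne' hV.ne']
  exact sub_le_sub (Real.log_le_log hg hgr) (Real.log_le_log ha haV)

/-- Adding `c` times a probability density `r` to the integrand `r * l` raises the difference of
the integrals of positive and negative part by at most `c`. -/
theorem posPart_sub_negPart_mul_add_const_le {X : Type*} [MeasurableSpace X] {μ : Measure X}
    {r l : X → ℝ} (hr : Integrable r μ) (hr1 : ∫ x, r x ∂μ = 1)
    (hm : AEStronglyMeasurable (fun x => r x * l x) μ)
    (hneg : ∫⁻ x, ENNReal.ofReal (-(r x * l x)) ∂μ ≠ ⊤) (c : ℝ) :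
    ((∫⁻ x, ENNReal.ofReal (r x * (l x + c)) ∂μ : ℝ≥0∞) : EReal)
        - ((∫⁻ x, ENNReal.ofReal (-(r x * (l x + c))) ∂μ : ℝ≥0∞) : EReal) ≤
      ((∫⁻ x, ENNReal.ofReal (r x * l x) ∂μ : ℝ≥0∞) : EReal)
        - ((∫⁻ x, ENNReal.ofReal (-(r x * l x)) ∂μ : ℝ≥0∞) : EReal) + (c : EReal) := by
  have key : ∀ f : X → ℝ, Integrable f μ →
      ((∫⁻ x, ENNReal.ofReal (f x) ∂μ : ℝ≥0∞) : EReal)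
        - ((∫⁻ x, ENNReal.ofReal (-f x) ∂μ : ℝ≥0∞) : EReal) = ((∫ x, f x ∂μ : ℝ) : EReal) := by
    intro f hf
    rw [integral_eq_lintegral_pos_part_sub_lintegral_neg_part hf, EReal.coe_sub,
      EReal.coe_ennreal_toReal hf.lintegral_lt_top.ne,
      EReal.coe_ennreal_toReal (x := ∫⁻ x, ENNReal.ofReal (-f x) ∂μ)
        hf.neg.lintegral_lt_top.ne]
  by_cases hpos : ∫⁻ x, ENNReal.ofReal (r x * l x) ∂μ = ⊤
  · lift ∫⁻ x, ENNReal.ofReal (-(r x * l x)) ∂μ to ℝ≥0 using hneg with b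
    rw [hpos]
    have : ((⊤ : ℝ≥0∞) : EReal) - (((b : ℝ≥0) : ℝ≥0∞) : EReal) + (c : EReal) = ⊤ := by
      rw [EReal.coe_ennreal_top, EReal.coe_nnreal_eq_coe_real, EReal.top_sub_coe,
        EReal.top_add_coe]
    rw [this]
    exact le_top
  have hint : Integrable (fun x => r x * l x) μ := by
    refine ⟨hm, ?_⟩
    rw [hasFiniteIntegral_iff_norm]
    have : ∀ x, ENNReal.ofReal ‖r x * l x‖
        ≤ ENNReal.ofReal (r x * l x) + ENNReal.ofReal (-(r x * l x)) := by
      intro x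
      rcases le_total 0 (r x * l x) with h | h
      · rw [Real.norm_of_nonneg h]; exact le_self_add
      · rw [Real.norm_of_nonpos h]; exact le_add_self
    refine (lintegral_mono this).trans_lt ?_
    rw [lintegral_add_left' hm.aemeasurable.ennreal_ofReal]
    exact ENNReal.add_lt_top.2 ⟨Ne.lt_top hpos, hneg.lt_top⟩
  have hsplit : (fun x => r x * (l x + c)) = fun x => r x * l x + r x * c := by
    funext x; ring
  have hint' : Integrable (fun x => r x * (l x + c)) μ := by
    rw [hsplit]; exact hint.add (hr.mul_const c)
  rw [key _ hint, key _ hint', hsplit, integral_add hint (hr.mul_const c), integral_mul_const,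
    hr1, one_mul, EReal.coe_add]

/-- The densities of the slices of `γ` over a countable partition sum up to the density of the
first marginal. -/
theorem tsum_rnDeriv_map_fst_restrict_eq {X Y : Type*} [MeasurableSpace X] [MeasurableSpace Y]
    {μ : Measure X} [SigmaFinite μ] {γ : Measure (X × Y)} [IsFiniteMeasure γ] {Q : ℕ → Set Y}
    (hQmeas : ∀ n, MeasurableSet (Q n)) (hQdisj : Pairwise (Function.onFun Disjoint Q))
    (hQcover : (⋃ n, Q n) = Set.univ) {ρ : X → ℝ≥0∞} (hρ : Measurable ρ)
    (hmarg : γ.map Prod.fst = μ.withDensity ρ) :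
    (fun x => ∑' n, ((γ.restrict (Set.univ ×ˢ Q n)).map Prod.fst).rnDeriv μ x) =ᵐ[μ] ρ := by
  set γn : ℕ → Measure X := fun n => (γ.restrict (Set.univ ×ˢ Q n)).map Prod.fst with hγn
  have hle : ∀ n, γn n ≤ μ.withDensity ρ := fun n => by
    rw [← hmarg]
    exact Measure.map_mono Measure.restrict_le_self measurable_fst
  have hdens : ∀ n, μ.withDensity ((γn n).rnDeriv μ) = γn n := fun n =>
    Measure.withDensity_rnDeriv_eq _ _
      ((hle n).absolutelyContinuous.trans (withDensity_absolutelyContinuous μ ρ))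
  have hrestr : Measure.sum (fun n => γ.restrict (Set.univ ×ˢ Q n)) = γ := by
    rw [← Measure.restrict_iUnion, ← Set.prod_iUnion, hQcover, Set.univ_prod_univ,
      Measure.restrict_univ]
    · intro i j hij
      exact Set.Disjoint.set_prod_right (hQdisj hij) _ _
    · exact fun n => MeasurableSet.univ.prod (hQmeas n)
  have hsum : Measure.sum γn = μ.withDensity ρ := by
    rw [← hmarg, hγn, ← Measure.map_sum measurable_fst.aemeasurable, hrestr]
  have hmeas : Measurable fun x => ∑' n, (γn n).rnDeriv μ x :=
    Measurable.tsum fun n => Measure.measurable_rnDeriv _ _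
  refine (withDensity_eq_iff_of_sigmaFinite hmeas.aemeasurable hρ.aemeasurable).1 ?_
  have htsum : (fun x => ∑' n, (γn n).rnDeriv μ x) = ∑' n, (γn n).rnDeriv μ := by
    funext x; rw [ENNReal.tsum_apply]
  rw [htsum, withDensity_tsum fun n => Measure.measurable_rnDeriv _ _, ← hsum]
  simp_rw [hdens]

/-- Integrating out the variable of a density that is constant on each cell of a partition. -/
theorem lintegral_tsum_indicator_div {Y : Type*} [MeasurableSpace Y] {ν : Measure Y}
    {Q : ℕ → Set Y} (hQmeas : ∀ n, MeasurableSet (Q n)) (h0 : ∀ n, ν (Q n) ≠ 0)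
    (htop : ∀ n, ν (Q n) ≠ ⊤) (g : ℕ → ℝ≥0∞) :
    ∫⁻ y, ∑' n, (Q n).indicator (fun _ => g n / ν (Q n)) y ∂ν = ∑' n, g n := by
  rw [lintegral_tsum fun n => (measurable_const.indicator (hQmeas n)).aemeasurable]
  refine tsum_congr fun n => ?_
  rw [lintegral_indicator_const (hQmeas n), ENNReal.div_mul_cancel (h0 n) (htop n)]

theorem tsum_indicator_eq_of_mem {Y : Type*} {Q : ℕ → Set Y}
    (hQdisj : Pairwise (Function.onFun Disjoint Q)) (a : ℕ → ℝ≥0∞) {n : ℕ} {y : Y}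
    (hy : y ∈ Q n) : ∑' m, (Q m).indicator (fun _ => a m) y = a n := by
  rw [tsum_eq_single n, Set.indicator_of_mem hy]
  exact fun m hm => Set.indicator_of_notMem
    (fun hym => Set.disjoint_left.1 (hQdisj hm) hym hy) _

/-- Projection of a plan onto piecewise constant second marginal: with cells of
volume `≥ δ^d`, the projected density `G(x,y) = g^Q(x)/ℒ^d(Q)` (for `y ∈ Q`) is a probability
density and its entropy is bounded by `∬ G log G ≤ ∫ ρ log ρ + d·log(1/δ)`. -/
theorem statement9 (d : ℕ) (hd : 1 ≤ d) (δ : ℝ) (hδ : 0 < δ)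
    (Q : ℕ → Set (Rd d)) (hQmeas : ∀ n, MeasurableSet (Q n))
    (hQdisj : Pairwise (Function.onFun Disjoint Q))
    (hQcover : (⋃ n, Q n) = Set.univ)
    (hQvol : ∀ n, ENNReal.ofReal (δ ^ d) ≤ volume (Q n)) (hQfin : ∀ n, volume (Q n) ≠ ⊤)
    (ρ : Rd d → ℝ≥0∞) (hρmeas : Measurable ρ)
    (hρ1 : (∫⁻ x, ρ x ∂(volume : Measure (Rd d))) = 1)
    (γ : Measure (Rd2 d)) (hγ : IsProbabilityMeasure γ)
    (hmarg : γ.map Prod.fst = (volume : Measure (Rd d)).withDensity ρ)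
    (hwelldef : (∫⁻ x, ENNReal.ofReal (-((ρ x).toReal * Real.log (ρ x).toReal))
        ∂(volume : Measure (Rd d))) ≠ ⊤)
    (G : Rd2 d → ℝ≥0∞)
    (hG : ∀ p : Rd2 d, G p = ∑' n, Set.indicator (Q n)
        (fun _ => (((γ.restrict (Set.univ ×ˢ Q n)).map Prod.fst).rnDeriv volume p.1)
          / volume (Q n)) p.2) :
    Measurable G ∧ (∫⁻ p, G p ∂(volume : Measure (Rd2 d))) = 1 ∧
      entropy (volume : Measure (Rd2 d)) ((volume : Measure (Rd2 d)).withDensity G)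
        ≤ entropy (volume : Measure (Rd d)) ((volume : Measure (Rd d)).withDensity ρ)
          + (((d : ℝ) * Real.log (1 / δ) : ℝ) : EReal) := by
  set V : Measure (Rd d) := volume with hV
  have hvol : (volume : Measure (Rd2 d)) = V.prod V := Measure.volume_eq_prod _ _
  set g : ℕ → Rd d → ℝ≥0∞ := fun n =>
    ((γ.restrict (Set.univ ×ˢ Q n)).map Prod.fst).rnDeriv V with hgdef
  have hgmeas : ∀ n, Measurable (g n) := fun n => Measure.measurable_rnDeriv _ _
  have hG' : ∀ x y, G (x, y) = ∑' n, (Q n).indicator (fun _ => g n x / V (Q n)) y :=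
    fun x y => hG (x, y)
  have ha : 0 < δ ^ d := pow_pos hδ d
  have hQ0 : ∀ n, V (Q n) ≠ 0 := fun n =>
    ((ENNReal.ofReal_pos.2 ha).trans_le (hQvol n)).ne'
  have hsum : (fun x => ∑' n, g n x) =ᵐ[V] ρ :=
    tsum_rnDeriv_map_fst_restrict_eq hQmeas hQdisj hQcover hρmeas hmarg
  have hGmeas : Measurable G := by
    have : G = fun p : Rd2 d => ∑' n, (Prod.snd ⁻¹' Q n).indicator
        (fun p : Rd2 d => g n p.1 / V (Q n)) p := funext fun p => hG p
    rw [this]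
    exact Measurable.tsum fun n =>
      (((hgmeas n).comp measurable_fst).div_const _).indicator (measurable_snd (hQmeas n))
  have hslice : ∀ x, ∫⁻ y, G (x, y) ∂V = ∑' n, g n x := fun x => by
    simp_rw [hG']
    exact lintegral_tsum_indicator_div hQmeas hQ0 hQfin fun n => g n x
  have hweight : ∀ w : Rd d → ℝ≥0∞, Measurable w →
      ∫⁻ p, G p * w p.1 ∂(V.prod V) = ∫⁻ x, ρ x * w x ∂V := fun w hw => by
    rw [lintegral_prod (fun p : Rd2 d => G p * w p.1)
      (hGmeas.mul (hw.comp measurable_fst)).aemeasurable]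
    refine lintegral_congr_ae ?_
    filter_upwards [hsum] with x hx
    have hGx : Measurable fun y => G (x, y) := hGmeas.comp measurable_prodMk_left
    rw [lintegral_mul_const _ hGx, hslice, hx]
  have hρtop : ∀ᵐ x ∂V, ρ x < ⊤ := ae_lt_top hρmeas (by rw [hρ1]; exact ENNReal.one_ne_top)
  have hρint : Integrable (fun x => (ρ x).toReal) V :=
    integrable_toReal_of_lintegral_ne_top hρmeas.aemeasurable
      (by rw [hρ1]; exact ENNReal.one_ne_top)
  have hρone : ∫ x, (ρ x).toReal ∂V = 1 := by
    rw [integral_toReal hρmeas.aemeasurable hρtop, hρ1, ENNReal.toReal_one]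
  set c : ℝ := (d : ℝ) * Real.log (1 / δ) with hc
  have hclog : c = -Real.log (δ ^ d) := by
    rw [hc, Real.log_pow, one_div, Real.log_inv]; ring
  set l : Rd d → ℝ := fun x => Real.log (ρ x).toReal with hl
  have hlmeas : Measurable l := Real.measurable_log.comp hρmeas.ennreal_toReal
  have hpt : ∀ᵐ p ∂(V.prod V), G p < ⊤ ∧
      (G p).toReal * Real.log (G p).toReal ≤ (G p).toReal * (l p.1 + c) := by
    have hx : ∀ᵐ x ∂V, ∑' n, g n x = ρ x ∧ ρ x < ⊤ := hsum.and hρtop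
    filter_upwards [Measure.quasiMeasurePreserving_fst.ae hx] with p hp
    obtain ⟨hp1, hp2⟩ := hp
    obtain ⟨n, hn⟩ := Set.mem_iUnion.1 (hQcover ▸ Set.mem_univ p.2)
    have hGp : G p = g n p.1 / V (Q n) :=
      (hG' p.1 p.2).trans (tsum_indicator_eq_of_mem hQdisj (fun n => g n p.1 / V (Q n)) hn)
    have hgle : g n p.1 ≤ ρ p.1 := hp1 ▸ ENNReal.le_tsum n
    refine ⟨hGp ▸ ENNReal.div_lt_top (hgle.trans_lt hp2).ne (hQ0 n), ?_⟩
    rw [hGp, ENNReal.toReal_div, hclog, ← sub_eq_add_neg]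
    exact div_mul_log_div_le ENNReal.toReal_nonneg (ENNReal.toReal_mono hp2.ne hgle) ha
      ((ENNReal.ofReal_le_iff_le_toReal (hQfin n)).1 (hQvol n))
  have hpart : ∀ w : Rd d → ℝ, Measurable w →
      ∫⁻ p, ENNReal.ofReal ((G p).toReal * w p.1) ∂(V.prod V)
        = ∫⁻ x, ENNReal.ofReal ((ρ x).toReal * w x) ∂V := fun w hw => by
    calc _ = ∫⁻ p, G p * ENNReal.ofReal (w p.1) ∂(V.prod V) := by
          refine lintegral_congr_ae ?_
          filter_upwards [hpt] with p hp
          rw [ENNReal.ofReal_mul ENNReal.toReal_nonneg, ENNReal.ofReal_toReal hp.1.ne]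
      _ = ∫⁻ x, ρ x * ENNReal.ofReal (w x) ∂V := hweight _ hw.ennreal_ofReal
      _ = _ := by
          refine lintegral_congr_ae ?_
          filter_upwards [hρtop] with x hx
          rw [ENNReal.ofReal_mul ENNReal.toReal_nonneg, ENNReal.ofReal_toReal hx.ne]
  refine ⟨hGmeas, ?_, ?_⟩
  · simpa [hvol, hρ1] using hweight (fun _ => 1) measurable_const
  rw [hvol, entropy_withDensity _ hGmeas, entropy_withDensity _ hρmeas]
  refine le_trans ?_ (posPart_sub_negPart_mul_add_const_le hρint hρone
    (hρmeas.ennreal_toReal.mul hlmeas).aestronglyMeasurable hwelldef c)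
  have hwm : Measurable fun x => l x + c := hlmeas.add_const c
  have hneg := hpart _ hwm.neg
  simp only [Pi.neg_apply, mul_neg] at hneg
  rw [← hpart _ hwm, ← hneg]
  refine EReal.sub_le_sub (EReal.coe_ennreal_le_coe_ennreal_iff.2 ?_)
    (EReal.coe_ennreal_le_coe_ennreal_iff.2 ?_)
  · refine lintegral_mono_ae ?_
    filter_upwards [hpt] with p hp using ENNReal.ofReal_le_ofReal hp.2
  · refine lintegral_mono_ae ?_
    filter_upwards [hpt] with p hp using ENNReal.ofReal_le_ofReal (neg_le_neg hp.2)
end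
end

section
/- Let d ≥ 1, τ > 0, δ > 0 and ω > 0, set σ := 12(δ + √ω), and assume σ ≤ τ/(4d) and δ ≤ τ/2. Then for every sign vector β ∈ {−1,+1}^d, the set S^β := {x ∈ ℝ^d : β_j x_j ≥ −τ/(4d) for all j = 1,…,d, and |x| ≤ τ + √ω} satisfies S^β − σβ ⊆ B̄_{τ−δ}, the closed Euclidean ball of radius τ−δ centered at the origin. In particular, every x with β_j x_j ≥ −τ/(4d) for all j and |x| = τ + √ω satisfies β·x ≥ τ/2 and |x − σβ| ≤ τ − δ. -/
open MeasureTheory Filter Topology BoundedContinuousFunction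
open scoped ENNReal NNReal

noncomputable section
open scoped Classical

/-- If every coordinate of `y` is at least `-c` with `4 n c = τ > 0` and `∑ y_j² = r²`, then
`∑ y_j` is at least `r - τ / 2`. -/
theorem sub_half_le_sum_of_neg_le {n : ℕ} (hn : 1 ≤ n) {τ c r : ℝ} (hτ : 0 < τ)
    (hc : 4 * n * c = τ) {y : Fin n → ℝ} (hy : ∀ j, -c ≤ y j) (hr : ∑ j, y j ^ 2 = r ^ 2) :
    r - τ / 2 ≤ ∑ j, y j := by
  have hn' : (1 : ℝ) ≤ n := by exact_mod_cast hn
  have hc0 : 0 < c := by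
    by_contra! h
    nlinarith
  have hcτ : 4 * c ≤ τ := by nlinarith
  have hz : ∀ j ∈ Finset.univ, 0 ≤ y j + c := fun j _ => by linarith [hy j]
  have hsq := Finset.sum_sq_le_sq_sum_of_nonneg hz
  have hA := Finset.sum_nonneg hz
  have h1 : ∑ j, (y j + c) = ∑ j, y j + τ / 4 := by
    rw [Finset.sum_add_distrib]
    simp
    linarith
  have h2 : ∑ j, (y j + c) ^ 2 = r ^ 2 + 2 * c * ∑ j, y j + c * (τ / 4) := by
    simp only [add_sq, Finset.sum_add_distrib, hr, Finset.mul_sum]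
    simp only [Finset.sum_const, Finset.card_univ, Fintype.card_fin, nsmul_eq_mul, ← hc]
    congr 1
    · congr 1
      exact Finset.sum_congr rfl fun j _ => by ring
    · ring
  rw [h1] at hA hsq
  rw [h2] at hsq
  by_contra! h
  nlinarith [mul_nonneg hc0.le hA]

/-- Expansion of `‖x - σ β‖²` for a sign vector `β`. -/
theorem norm_sub_smul_sign_sq {n : ℕ} (σ : ℝ) {β : Rd n} (hβ : ∀ j, β j = 1 ∨ β j = -1)
    (x : Rd n) :
    ‖x - σ • β‖ ^ 2 = ‖x‖ ^ 2 - 2 * σ * ∑ j, β j * x j + n * σ ^ 2 := by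
  simp only [EuclideanSpace.real_norm_sq_eq, Finset.mul_sum, ← Finset.sum_sub_distrib]
  have hn : (n : ℝ) * σ ^ 2 = ∑ _j : Fin n, σ ^ 2 := by simp
  rw [hn, ← Finset.sum_add_distrib]
  refine Finset.sum_congr rfl fun j _ => ?_
  rcases hβ j with h | h <;> simp [h] <;> ring

/-- Geometry of the translated sectors: with `σ := 12(δ+√ω)`, `σ ≤ τ/(4d)`,
`δ ≤ τ/2`, the sector `S^β = {x : β_j x_j ≥ −τ/(4d) ∀j, |x| ≤ τ+√ω}` satisfies
`S^β − σβ ⊆ B̄_{τ−δ}`; in particular every cap point `x` (with `|x| = τ+√ω`) satisfies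
`β·x ≥ τ/2` and `|x − σβ| ≤ τ−δ`. -/
theorem statement10 (d : ℕ) (hd : 1 ≤ d) (τ δ ω : ℝ) (hτ : 0 < τ) (hδ : 0 < δ) (hω : 0 < ω)
    (σ : ℝ) (hσ : σ = 12 * (δ + Real.sqrt ω))
    (hστ : σ ≤ τ / (4 * d)) (hδτ : δ ≤ τ / 2)
    (β : Rd d) (hβ : ∀ j : Fin d, β j = 1 ∨ β j = -1) :
    (∀ x : Rd d, (∀ j : Fin d, -(τ / (4 * d)) ≤ β j * x j) → ‖x‖ ≤ τ + Real.sqrt ω →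
      x - σ • β ∈ Metric.closedBall (0 : Rd d) (τ - δ)) ∧
    (∀ x : Rd d, (∀ j : Fin d, -(τ / (4 * d)) ≤ β j * x j) → ‖x‖ = τ + Real.sqrt ω →
      τ / 2 ≤ ∑ j : Fin d, β j * x j ∧ ‖x - σ • β‖ ≤ τ - δ) := by
  obtain ⟨hs, hd'⟩ : 0 < Real.sqrt ω ∧ (1 : ℝ) ≤ d := ⟨Real.sqrt_pos.2 hω, by exact_mod_cast hd⟩
  have hc : 4 * d * (τ / (4 * d)) = τ := by field_simp
  have hσd : 4 * d * σ ≤ τ :=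
    (mul_le_mul_of_nonneg_left hστ (by positivity)).trans_eq hc
  have hsum : ∀ x : Rd d, (∀ j : Fin d, -(τ / (4 * d)) ≤ β j * x j) →
      ‖x‖ - τ / 2 ≤ ∑ j, β j * x j := fun x hx =>
    sub_half_le_sum_of_neg_le hd hτ hc hx (by
      rw [EuclideanSpace.real_norm_sq_eq]
      exact Finset.sum_congr rfl fun j _ => by rcases hβ j with h | h <;> simp [h])
  have hball : ∀ x : Rd d, (∀ j : Fin d, -(τ / (4 * d)) ≤ β j * x j) →
      ‖x‖ ≤ τ + Real.sqrt ω → ‖x - σ • β‖ ≤ τ - δ := by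
    intro x hx hxn
    have hS := hsum x hx
    have hr := norm_nonneg x
    have hexp := norm_sub_smul_sign_sq σ hβ x
    generalize ‖x‖ = r at *
    generalize Real.sqrt ω = s at *
    have hσ0 : 0 < σ := by linarith
    have hσ4 : 4 * σ ≤ τ := by nlinarith
    have hdσ : d * σ ^ 2 ≤ σ * τ / 4 := by nlinarith
    have hSσ := mul_le_mul_of_nonneg_left hS hσ0.le
    have hrr : r ^ 2 - 2 * σ * r ≤ (τ + s) ^ 2 - 2 * σ * (τ + s) := by
      nlinarith [mul_nonneg (sub_nonneg.2 hxn) (by linarith : 0 ≤ r + (τ + s) - 2 * σ)]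
    have hsτ : 48 * s ≤ τ := by linarith
    refine (sq_le_sq₀ (norm_nonneg _) (by linarith)).1 ?_
    have h1 : s ^ 2 ≤ s * τ := by nlinarith
    have h2 : σ * τ = 12 * (δ * τ + s * τ) := by rw [hσ]; ring
    nlinarith [mul_pos hs hτ, mul_pos hδ hτ, mul_pos hσ0 hs]
  refine ⟨fun x hx hxn => mem_closedBall_zero_iff.2 (hball x hx hxn), fun x hx hxn =>
    ⟨?_, hball x hx hxn.le⟩⟩
  linarith [hsum x hx]
end
end
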